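/- arXiv:1701.02316 — 2 statements merged into one kernel-verified Lean document; each statement's English description precedes it below -/
import Mathlib

section
/- For every m ≥ 1, the extremal weight projector t_m ∈ End(V^{⊗m}) is the projection onto the extremal weight space: t_m(v_ε) = v_ε if ε is constant (all entries + or all entries −), and t_m(v_ε) = 0 for every non-constant sign string ε ∈ {+,−}^m. In particular t_m is idempotent with image span{v₊^{⊗m}, v₋^{⊗m}}. -/
open Matrix

noncomputable section

/-- Sign strings `ε ∈ {+,-}^m`; `true` encodes `+` and `false` encodes `-`. -/
abbrev Sgn (m : ℕ) := Fin m → Bool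

/-- Endomorphisms of `V^{⊗m}` (`V = ℂ²`), as matrices indexed by sign strings. -/
abbrev Op (m : ℕ) := Matrix (Sgn m) (Sgn m) ℂ

/-- Linear maps `V^{⊗m} → V^{⊗n}`, as matrices (rows: target, columns: source). -/
abbrev Mor (m n : ℕ) := Matrix (Sgn n) (Sgn m) ℂ

/-- The basis vector `v_ε` of `V^{⊗m}`. -/
def bv {m : ℕ} (ε : Sgn m) : Sgn m → ℂ := fun δ => if δ = ε then 1 else 0

/-- The coefficient of `cap` on `v_a ⊗ v_b`:
`cap (v₋ ⊗ v₊) = 1`, `cap (v₊ ⊗ v₋) = -1`, `cap (v₊ ⊗ v₊) = cap (v₋ ⊗ v₋) = 0`. -/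
def capc (a b : Bool) : ℂ := if a then (if b then 0 else -1) else (if b then 1 else 0)

/-- The coefficient of `v_a ⊗ v_b` in `cup 1 = v₊ ⊗ v₋ - v₋ ⊗ v₊`. -/
def cupc (a b : Bool) : ℂ := if a then (if b then 0 else 1) else (if b then -1 else 0)

/-- The cap `V ⊗ V → ℂ`. -/
def capM : Mor 2 0 := Matrix.of fun _ ε => capc (ε 0) (ε 1)

/-- The cup `ℂ → V ⊗ V`. -/
def cupM : Mor 0 2 := Matrix.of fun δ _ => cupc (δ 0) (δ 1)

/-- The tensor product of two linear maps. -/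
def tensMor {a b c d : ℕ} (A : Mor a b) (B : Mor c d) : Mor (a + c) (b + d) :=
  Matrix.of fun δ ε =>
    A (fun i => δ (Fin.castAdd d i)) (fun i => ε (Fin.castAdd c i)) *
      B (fun j => δ (Fin.natAdd b j)) (fun j => ε (Fin.natAdd a j))

/-- The swap of the two tensor factors of `V ⊗ V`. -/
def swap2 : Op 2 := Matrix.of fun δ ε => if δ 0 = ε 1 ∧ δ 1 = ε 0 then 1 else 0

/-- `id^{⊗p} ⊗ A ⊗ id^{⊗(m-p-2)}`: the operator `A` on two strands placed at the
(0-based) positions `p`, `p+1` among `m` strands. -/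
def atPos (m p : ℕ) (A : Op 2) : Op m :=
  Matrix.of fun δ ε =>
    if h : p + 2 ≤ m then
      (if ∀ k : Fin m, k.val ≠ p → k.val ≠ p + 1 → δ k = ε k then 1 else 0) *
        A (fun i => δ ⟨p + i.val, Nat.lt_of_lt_of_le (Nat.add_lt_add_left i.isLt p) h⟩)
          (fun i => ε ⟨p + i.val, Nat.lt_of_lt_of_le (Nat.add_lt_add_left i.isLt p) h⟩)
    else 0

/-- Cyclic rotation of sign strings: `(rotIdx δ) k = δ (k+1 mod m)`. -/
def rotIdx {m : ℕ} (δ : Sgn m) : Sgn m := fun k => δ ⟨(k.val + 1) % m, Nat.mod_lt _ k.pos⟩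

/-- The rotation `d_m : V^{⊗m} → V^{⊗m}`, `d_m (v_ε ⊗ w) = i^{ε} (w ⊗ v_ε)`. -/
def dRot : (m : ℕ) → Op m
  | 0 => 1
  | (m + 1) =>
    Matrix.of fun δ' δ =>
      if δ' = rotIdx δ then (if δ 0 then Complex.I else -Complex.I) else 0

/-- The cap-cup generator `u_j` (`j` is 1-based, `1 ≤ j ≤ m-1`);
`u_0 := d_m⁻¹ ∘ u_1 ∘ d_m` is the affine generator. -/
def uFull (m j : ℕ) : Op m :=
  if j = 0 then (dRot m)⁻¹ * atPos m 0 (cupM * capM) * dRot m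
  else atPos m (j - 1) (cupM * capM)

/-- The extremal weight projectors `t_m`, defined by `t₁ = id`,
`t₂ = id + u₁/2 + u₀/2`, and `t_{m+1} = (t_m ⊗ id) ∘ σ_m ∘ (t_m ⊗ id)` for `m ≥ 2`
(with the convention `t₀ = 2·id`). -/
def tP : (m : ℕ) → Op m
  | 0 => (2 : ℂ) • 1
  | 1 => 1
  | 2 => 1 + (2⁻¹ : ℂ) • atPos 2 0 (cupM * capM) +
      (2⁻¹ : ℂ) • ((dRot 2)⁻¹ * atPos 2 0 (cupM * capM) * dRot 2)
  | (m + 3) =>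
    tensMor (tP (m + 2)) (1 : Op 1) * atPos (m + 3) (m + 1) swap2 *
      tensMor (tP (m + 2)) (1 : Op 1)

/-- `n` nested caps `Ca_n : V^{⊗2n} → ℂ`. -/
def CaM (n : ℕ) : Mor (n + n) 0 :=
  Matrix.of fun _ δ =>
    ∏ k : Fin n,
      capc (δ ⟨k.val, Nat.lt_of_lt_of_le k.isLt (Nat.le_add_right n n)⟩)
        (δ ⟨n + n - 1 - k.val,
          Nat.lt_of_le_of_lt (Nat.sub_le _ _)
            (Nat.sub_lt (Nat.lt_of_lt_of_le k.pos (Nat.le_add_right n n)) Nat.one_pos)⟩)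

/-- `n` nested cups `Cu_n : ℂ → V^{⊗2n}`. -/
def CuM (n : ℕ) : Mor 0 (n + n) :=
  Matrix.of fun δ _ =>
    ∏ k : Fin n,
      cupc (δ ⟨k.val, Nat.lt_of_lt_of_le k.isLt (Nat.le_add_right n n)⟩)
        (δ ⟨n + n - 1 - k.val,
          Nat.lt_of_le_of_lt (Nat.sub_le _ _)
            (Nat.sub_lt (Nat.lt_of_lt_of_le k.pos (Nat.le_add_right n n)) Nat.one_pos)⟩)

/-- The canonical identification of sign strings induced by an equality of lengths. -/
def sgnCast {a b : ℕ} (h : a = b) : Sgn a ≃ Sgn b :=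
  Equiv.arrowCongr (finCongr h) (Equiv.refl Bool)

/-- Reindexing of a linear map along equalities of the numbers of strands. -/
def rc {a b c d : ℕ} (h1 : a = b) (h2 : c = d) (A : Mor a c) : Mor b d :=
  Matrix.reindex (sgnCast h2) (sgnCast h1) A

/-- The idempotents `e_{m,n}`:
`e_{1,1} = -u₁/2 - d₂⁻¹ ∘ u₁ ∘ d₂ / 2` and
`e_{m,n} = -(t_m ⊗ t_n) ∘ u_m ∘ (t_m ⊗ t_n)` otherwise. -/
def eP : (m n : ℕ) → Op (m + n)
  | 1, 1 =>
    (-(2⁻¹ : ℂ)) • atPos 2 0 (cupM * capM) +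
      (-(2⁻¹ : ℂ)) • ((dRot 2)⁻¹ * atPos 2 0 (cupM * capM) * dRot 2)
  | m, n =>
    -(tensMor (tP m) (tP n) * atPos (m + n) (m - 1) (cupM * capM) * tensMor (tP m) (tP n))

/-- A sign string is constant if all its entries are `+` or all its entries are `-`. -/
def IsConst {m : ℕ} (ε : Sgn m) : Prop := (∀ k, ε k = true) ∨ (∀ k, ε k = false)

instance {m : ℕ} : DecidablePred (IsConst (m := m)) :=
  fun ε => inferInstanceAs (Decidable ((∀ k, ε k = true) ∨ (∀ k, ε k = false)))

/-- The diagonal matrix projecting onto the span of the constant basis vectors. -/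
def constProj (m : ℕ) : Op m := diagonal fun ε => if IsConst ε then 1 else 0

theorem isConst_iff {m : ℕ} (ε : Sgn (m + 1)) : IsConst ε ↔ ∀ k, ε k = ε 0 := by
  constructor
  · rintro (h | h) k <;> rw [h, h]
  · intro h
    cases h0 : ε 0
    · exact Or.inr fun k => (h k).trans h0
    · exact Or.inl fun k => (h k).trans h0

theorem bv_eq_single {m : ℕ} (ε : Sgn m) : bv ε = Pi.single ε 1 := by
  ext δ
  simp [bv, Pi.single_apply]

theorem constProj_mulVec_bv {m : ℕ} (ε : Sgn m) :
    (constProj m).mulVec (bv ε) = if IsConst ε then bv ε else 0 := by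
  ext δ
  rw [constProj, mulVec_diagonal]
  by_cases h : δ = ε
  · subst h
    split_ifs <;> simp [bv]
  · split_ifs <;> simp [bv, h]

theorem constProj_mul_self (m : ℕ) : constProj m * constProj m = constProj m := by
  simp [constProj, diagonal_mul_diagonal]

theorem range_constProj (m : ℕ) :
    LinearMap.range (constProj m).mulVecLin =
      Submodule.span ℂ {bv (fun _ : Fin m => true), bv (fun _ : Fin m => false)} := by
  rw [range_mulVecLin]
  have hcol (ε : Sgn m) : (constProj m).col ε = if IsConst ε then bv ε else 0 := by
    rw [← constProj_mulVec_bv, bv_eq_single, mulVec_single_one]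
  apply le_antisymm <;> rw [Submodule.span_le]
  · rintro _ ⟨ε, rfl⟩
    rw [hcol]
    split_ifs with h
    · apply Submodule.subset_span
      rcases h with h | h
      · exact Or.inl (congrArg bv (funext h))
      · exact Or.inr (congrArg bv (funext h))
    · exact Submodule.zero_mem _
  · rintro _ (rfl | rfl)
    · exact Submodule.subset_span ⟨_, (hcol _).trans (if_pos (Or.inl fun _ => rfl))⟩
    · exact Submodule.subset_span ⟨_, (hcol _).trans (if_pos (Or.inr fun _ => rfl))⟩

theorem tensMor_diagonal_one {m n : ℕ} (f : Sgn m → ℂ) :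
    tensMor (diagonal f) (1 : Op n) = diagonal fun ε => f fun i => ε (Fin.castAdd n i) := by
  ext δ ε
  simp only [tensMor, of_apply, diagonal_apply, one_apply]
  by_cases h : δ = ε
  · simp [h]
  · rw [if_neg h]
    by_cases h₁ : (fun i => δ (Fin.castAdd n i)) = fun i => ε (Fin.castAdd n i)
    · have h₂ : ¬ (fun j => δ (Fin.natAdd m j)) = fun j => ε (Fin.natAdd m j) := fun h₂ =>
        h (funext fun k => Fin.addCases (congrFun h₁) (congrFun h₂) k)
      rw [if_neg h₂, mul_zero]
    · rw [if_neg h₁, zero_mul]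

theorem constProj_swap_constProj (m : ℕ) :
    tensMor (constProj (m + 2)) (1 : Op 1) * atPos (m + 3) (m + 1) swap2 *
      tensMor (constProj (m + 2)) (1 : Op 1) = constProj (m + 3) := by
  ext δ ε
  rw [constProj, tensMor_diagonal_one, mul_diagonal, diagonal_mul, constProj, diagonal_apply]
  simp only [isConst_iff, atPos, swap2, of_apply]
  rw [dif_pos (by omega)]
  by_cases h : δ = ε
  · subst h
    by_cases hδ : ∀ k, δ k = δ 0
    · have h₀ (k l : Fin (m + 3)) : δ k = δ l := (hδ k).trans (hδ l).symm
      rw [if_pos fun k => h₀ _ _, if_pos fun _ _ _ => rfl, if_pos ⟨h₀ _ _, h₀ _ _⟩,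
        if_pos rfl, if_pos hδ]
      norm_num
    · rw [if_pos rfl, if_neg hδ]
      split_ifs with h₁ h₂ h₃ <;> simp
      refine hδ fun k => ?_
      induction k using Fin.lastCases with
      | last => exact h₃.2.trans (h₁ (Fin.last (m + 1)))
      | cast k => exact h₁ k
  · rw [if_neg h]
    split_ifs with h₁ h₂ h₃ h₄ <;> simp
    have h₀ : δ 0 = ε 0 := h₂ 0 (by simp) (by simp)
    have hlast₁ : δ (Fin.castSucc (Fin.last (m + 1))) = ε (Fin.last (m + 2)) := h₃.1
    have hlast₂ : δ (Fin.last (m + 2)) = ε (Fin.castSucc (Fin.last (m + 1))) := h₃.2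
    have hδ : δ (Fin.castSucc (Fin.last (m + 1))) = δ 0 := h₁ (Fin.last (m + 1))
    have hε : ε (Fin.castSucc (Fin.last (m + 1))) = ε 0 := h₄ (Fin.last (m + 1))
    refine h (funext fun k => ?_)
    induction k using Fin.lastCases with
    | last => rw [hlast₂, hε, ← hlast₁, hδ, h₀]
    | cast k => exact (h₁ k).trans (h₀.trans (h₄ k).symm)

theorem sum_sgn_two (f : Sgn 2 → ℂ) :
    ∑ ε, f ε = f ![true, true] + f ![true, false] + f ![false, true] + f ![false, false] := by
  rw [← (finTwoArrowEquiv Bool).symm.sum_comp, Fintype.sum_prod_type]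
  simp only [finTwoArrowEquiv, Fintype.sum_bool]
  exact (add_assoc _ _ _).symm

theorem forall_sgn_two {p : Sgn 2 → Prop} (h₁ : p ![true, true]) (h₂ : p ![true, false])
    (h₃ : p ![false, true]) (h₄ : p ![false, false]) (ε : Sgn 2) : p ε := by
  obtain ⟨⟨a, b⟩, rfl⟩ := (finTwoArrowEquiv Bool).symm.surjective ε
  cases a <;> cases b <;> assumption

theorem atPos_two (A : Op 2) : atPos 2 0 A = A := by
  ext δ ε
  have h (k : Fin 2) (h₀ : k.val ≠ 0) (h₁ : k.val ≠ 0 + 1) : δ k = ε k := by omega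
  rw [atPos, of_apply, dif_pos (by omega), if_pos h, one_mul]
  congr <;> ext i <;> congr <;> simp

theorem dRot_two_inv : (dRot 2)⁻¹ = (dRot 2)ᴴ := by
  apply inv_eq_right_inv
  ext δ ε
  rw [mul_apply, sum_sgn_two]
  revert ε
  revert δ
  apply forall_sgn_two <;> apply forall_sgn_two <;>
    simp [dRot, rotIdx, funext_iff, Fin.forall_fin_two, one_apply]

theorem tP_two : tP 2 = constProj 2 := by
  rw [tP, dRot_two_inv, atPos_two]
  ext δ ε
  simp only [Matrix.add_apply, Matrix.smul_apply, mul_apply, sum_sgn_two]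
  revert ε
  revert δ
  apply forall_sgn_two <;> apply forall_sgn_two <;>
    simp [dRot, rotIdx, funext_iff, Fin.forall_fin_two, one_apply, constProj,
      isConst_iff, capM, cupM, capc, cupc]
  all_goals norm_num

theorem tP_eq_constProj : ∀ m : ℕ, 1 ≤ m → tP m = constProj m
  | 1, _ => by
    have h (ε : Sgn 1) : IsConst ε :=
      (isConst_iff ε).2 fun k => congrArg ε (Subsingleton.elim (α := Fin 1) k 0)
    simp [tP, constProj, h]
  | 2, _ => tP_two
  | m + 3, _ => by
    rw [tP, tP_eq_constProj (m + 2) (by omega), constProj_swap_constProj]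

/-- `t_m` is the projection onto the extremal weight space. -/
theorem extremal_weight_projector_is_projection (m : ℕ) (hm : 1 ≤ m) :
    (∀ ε : Sgn m, ((∀ k, ε k = true) ∨ (∀ k, ε k = false)) →
      (tP m).mulVec (bv ε) = bv ε) ∧
    (∀ ε : Sgn m, ¬ ((∀ k, ε k = true) ∨ (∀ k, ε k = false)) →
      (tP m).mulVec (bv ε) = 0) ∧
    tP m * tP m = tP m ∧
    LinearMap.range (tP m).mulVecLin =
      Submodule.span ℂ {bv (fun _ : Fin m => true), bv (fun _ : Fin m => false)} := by
  rw [tP_eq_constProj m hm]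
  refine ⟨fun ε h => ?_, fun ε h => ?_, constProj_mul_self m, range_constProj m⟩
  · rw [constProj_mulVec_bv]
    exact if_pos h
  · rw [constProj_mulVec_bv]
    exact if_neg h
end
end

section
/- (Vanishing of the essential circle) The evaluation of a circle that wraps once around the annulus is zero: the linear maps cap ∘ d₂ ∘ cup : ℂ → ℂ and cap ∘ d₂⁻¹ ∘ cup : ℂ → ℂ are both zero. -/
open Matrix

noncomputable section

theorem eq_rotIdx_two_iff (δ ε : Sgn 2) : δ = rotIdx ε ↔ ![δ 1, δ 0] = ε := by
  simp only [funext_iff, Fin.forall_fin_two, rotIdx]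
  simpa using and_comm

theorem dRot_two_mul_apply {n : ℕ} (A : Mor n 2) (δ : Sgn 2) (ε : Sgn n) :
    (dRot 2 * A) δ ε = (if δ 1 then Complex.I else -Complex.I) * A ![δ 1, δ 0] ε := by
  simp [dRot, Matrix.mul_apply, eq_rotIdx_two_iff]
  congr

theorem dRot_two_mul_dRot_two_mul_apply {n : ℕ} (A : Mor n 2) (δ : Sgn 2) (ε : Sgn n) :
    (dRot 2 * (dRot 2 * A)) δ ε = (if δ 0 = δ 1 then -1 else 1) * A δ ε := by
  have h : ![δ 0, δ 1] = δ := by ext k; fin_cases k <;> rfl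
  rw [dRot_two_mul_apply, dRot_two_mul_apply]
  cases h0 : δ 0 <;> cases h1 : δ 1 <;> rw [h0, h1] at h <;> simp [h, ← mul_assoc]

theorem isUnit_det_dRot_two : IsUnit (dRot 2).det := by
  refine Matrix.isUnit_det_of_right_inverse (B := dRot 2 * (dRot 2 * (dRot 2 * 1))) ?_
  ext δ ε
  rw [dRot_two_mul_dRot_two_mul_apply, dRot_two_mul_dRot_two_mul_apply]
  split_ifs <;> simp

theorem dRot_two_mul_dRot_two_mul_cupM : dRot 2 * (dRot 2 * cupM) = cupM := by
  ext δ ε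
  rw [dRot_two_mul_dRot_two_mul_apply]
  cases h0 : δ 0 <;> cases h1 : δ 1 <;> simp [cupM, cupc, h0, h1]

theorem inv_dRot_two_mul_cupM : (dRot 2)⁻¹ * cupM = dRot 2 * cupM := by
  conv_lhs => rw [← dRot_two_mul_dRot_two_mul_cupM]
  exact Matrix.nonsing_inv_mul_cancel_left _ _ isUnit_det_dRot_two

theorem capM_mul_dRot_two_mul_cupM : capM * dRot 2 * cupM = 0 := by
  ext δ ε
  rw [Matrix.mul_assoc, Matrix.mul_apply,
    ← (finTwoArrowEquiv Bool).symm.sum_comp, Fintype.sum_prod_type]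
  simp [dRot_two_mul_apply, capM, cupM, capc, cupc]

/-- Vanishing of the essential circle: `cap ∘ d₂ ∘ cup = 0` and
`cap ∘ d₂⁻¹ ∘ cup = 0`. -/
theorem essential_circle_vanishes :
    capM * dRot 2 * cupM = 0 ∧ capM * (dRot 2)⁻¹ * cupM = 0 := by
  refine ⟨capM_mul_dRot_two_mul_cupM, ?_⟩
  rw [Matrix.mul_assoc, inv_dRot_two_mul_cupM, ← Matrix.mul_assoc, capM_mul_dRot_two_mul_cupM]
end
end
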